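/- Let p ∈ (2, 2*_s) and η > 0, and let u : ℝ^N → ℝ be measurable with [u]² < ∞, ‖u‖_{2*_s} < ∞ and ‖u‖_p < ∞. Then the map ξ ↦ I_η(ξ⋆u) from ℝ to ℝ is differentiable, and its derivative at every ξ ∈ ℝ equals s · P_η(ξ⋆u). -/

import Mathlib

open MeasureTheory Filter Topology
open scoped ENNReal

noncomputable section

/-- Squared Gagliardo seminorm `[u]²` (possibly infinite). -/
def gagliardo (N : ℕ) (s : ℝ) (u : EuclideanSpace ℝ (Fin N) → ℝ) : ℝ≥0∞ :=
  ∫⁻ x : EuclideanSpace ℝ (Fin N), ∫⁻ y : EuclideanSpace ℝ (Fin N),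
    ENNReal.ofReal (|u x - u y| ^ 2 / ‖x - y‖ ^ ((N : ℝ) + 2 * s))

/-- `∫ |u|^q dx`, i.e. `‖u‖_q^q` (possibly infinite). -/
def lpint (N : ℕ) (q : ℝ) (u : EuclideanSpace ℝ (Fin N) → ℝ) : ℝ≥0∞ :=
  ∫⁻ x : EuclideanSpace ℝ (Fin N), ENNReal.ofReal (|u x| ^ q)

/-- The scaling `(ξ ⋆ u)(x) = e^{Nξ/2} u(e^ξ x)`. -/
def scaleFn (N : ℕ) (ξ : ℝ) (u : EuclideanSpace ℝ (Fin N) → ℝ) :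
    EuclideanSpace ℝ (Fin N) → ℝ :=
  fun x => Real.exp ((N : ℝ) * ξ / 2) * u (Real.exp ξ • x)

/-- The fractional critical Sobolev exponent `2*_s = 2N/(N-2s)`. -/
def critExp (N : ℕ) (s : ℝ) : ℝ := 2 * N / ((N : ℝ) - 2 * s)

/-- `ζ_p = N(p-2)/(2ps)`. -/
def zetaP (N : ℕ) (s p : ℝ) : ℝ := (N : ℝ) * (p - 2) / (2 * p * s)

/-- The energy functional `I_η`. -/
def energy (N : ℕ) (s p η : ℝ) (u : EuclideanSpace ℝ (Fin N) → ℝ) : ℝ :=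
  (1 / 2) * (gagliardo N s u).toReal - (1 / critExp N s) * (lpint N (critExp N s) u).toReal
    - (η / p) * (lpint N p u).toReal

/-- The Pohozaev functional `P_η`. -/
def pohozaev (N : ℕ) (s p η : ℝ) (u : EuclideanSpace ℝ (Fin N) → ℝ) : ℝ :=
  (gagliardo N s u).toReal - (lpint N (critExp N s) u).toReal
    - η * zetaP N s p * (lpint N p u).toReal

/-- The quantity `ρ(m,η)` from Lemma 2.2. -/
def rhoDef (N : ℕ) (s p η m S C : ℝ) : ℝ :=
  min ((p / (8 * η * C ^ p * (2 : ℝ) ^ (((N : ℝ) * p - 2 * N) / (4 * s)) *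
        m ^ ((2 * s * p - (N : ℝ) * p + 2 * N) / (2 * s)))) ^
          (4 * s / ((N : ℝ) * p - 2 * N - 4 * s)))
      ((critExp N s / 8) ^ (((N : ℝ) - 2 * s) / (2 * s)) * (S / 2) ^ ((N : ℝ) / (2 * s)))

/-- Change of variables `x ↦ e^t x` for the lower Lebesgue integral. -/
theorem lintegral_comp_exp_smul (N : ℕ) (t : ℝ) (f : EuclideanSpace ℝ (Fin N) → ℝ≥0∞) :
    ∫⁻ x, f (Real.exp t • x) = ENNReal.ofReal (Real.exp (-(N * t))) * ∫⁻ x, f x := by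
  have ht : Real.exp t ≠ 0 := (Real.exp_pos t).ne'
  have h := lintegral_map_equiv (μ := volume) f
    (Homeomorph.smulOfNeZero (α := EuclideanSpace ℝ (Fin N)) (Real.exp t) ht).toMeasurableEquiv
  have hm := Measure.map_addHaar_smul (volume : Measure (EuclideanSpace ℝ (Fin N))) ht
  have hc : |(Real.exp t ^ Module.finrank ℝ (EuclideanSpace ℝ (Fin N)))⁻¹|
      = Real.exp (-(N * t)) := by
    rw [finrank_euclideanSpace_fin, ← Real.exp_nat_mul, ← Real.exp_neg, Real.abs_exp]
  rw [hc] at hm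
  change ∫⁻ x, f x ∂(Measure.map (Real.exp t • ·) volume) = ∫⁻ x, f (Real.exp t • x) at h
  rw [← h, hm, lintegral_smul_measure, smul_eq_mul]

theorem lpint_scaleFn (N : ℕ) (q t : ℝ) (u : EuclideanSpace ℝ (Fin N) → ℝ) :
    lpint N q (scaleFn N t u)
      = ENNReal.ofReal (Real.exp ((N * q / 2 - N) * t)) * lpint N q u := by
  have h : ∀ x, ENNReal.ofReal (|scaleFn N t u x| ^ q)
      = ENNReal.ofReal (Real.exp (N * t / 2 * q))
        * ENNReal.ofReal (|u (Real.exp t • x)| ^ q) := by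
    intro x
    rw [← ENNReal.ofReal_mul (Real.exp_pos _).le, scaleFn, abs_mul, Real.abs_exp,
      Real.mul_rpow (Real.exp_pos _).le (abs_nonneg _), ← Real.exp_mul]
  unfold lpint
  simp_rw [h]
  rw [lintegral_const_mul' _ _ ENNReal.ofReal_ne_top,
    lintegral_comp_exp_smul N t fun x => ENNReal.ofReal (|u x| ^ q), ← mul_assoc,
    ← ENNReal.ofReal_mul (Real.exp_pos _).le, ← Real.exp_add]
  ring_nf

theorem gagliardo_scaleFn (N : ℕ) (s t : ℝ) (u : EuclideanSpace ℝ (Fin N) → ℝ) :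
    gagliardo N s (scaleFn N t u)
      = ENNReal.ofReal (Real.exp (2 * s * t)) * gagliardo N s u := by
  have h : ∀ x y, ENNReal.ofReal
        (|scaleFn N t u x - scaleFn N t u y| ^ 2 / ‖x - y‖ ^ ((N : ℝ) + 2 * s))
      = ENNReal.ofReal (Real.exp (N * t + t * (N + 2 * s)))
        * ENNReal.ofReal (|u (Real.exp t • x) - u (Real.exp t • y)| ^ 2
          / ‖Real.exp t • x - Real.exp t • y‖ ^ ((N : ℝ) + 2 * s)) := by
    intro x y
    have he : Real.exp (N * t / 2) ^ 2 = Real.exp (N * t) := by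
      rw [← Real.exp_nat_mul]; congr 1; push_cast; ring
    rw [← ENNReal.ofReal_mul (Real.exp_pos _).le, scaleFn, scaleFn, ← mul_sub, ← smul_sub,
      norm_smul, abs_mul, Real.abs_exp, Real.norm_eq_abs, Real.abs_exp,
      Real.mul_rpow (Real.exp_pos _).le (norm_nonneg _), ← Real.exp_mul, mul_pow, he,
      Real.exp_add]
    have hE := (Real.exp_pos (t * (N + 2 * s))).ne'
    rw [← mul_div_assoc, mul_assoc, mul_left_comm, mul_div_mul_left _ _ hE]
  unfold gagliardo
  simp_rw [h]
  have hy : ∀ x, ∫⁻ y, ENNReal.ofReal (Real.exp (N * t + t * (N + 2 * s)))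
        * ENNReal.ofReal (|u (Real.exp t • x) - u (Real.exp t • y)| ^ 2
          / ‖Real.exp t • x - Real.exp t • y‖ ^ ((N : ℝ) + 2 * s))
      = ENNReal.ofReal (Real.exp (2 * s * t + N * t))
        * ∫⁻ y, ENNReal.ofReal (|u (Real.exp t • x) - u y| ^ 2
          / ‖Real.exp t • x - y‖ ^ ((N : ℝ) + 2 * s)) := by
    intro x
    rw [lintegral_const_mul' _ _ ENNReal.ofReal_ne_top,
      lintegral_comp_exp_smul N t fun y => ENNReal.ofReal (|u (Real.exp t • x) - u y| ^ 2
          / ‖Real.exp t • x - y‖ ^ ((N : ℝ) + 2 * s)), ← mul_assoc,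
      ← ENNReal.ofReal_mul (Real.exp_pos _).le, ← Real.exp_add]
    ring_nf
  simp_rw [hy]
  rw [lintegral_const_mul' _ _ ENNReal.ofReal_ne_top,
    lintegral_comp_exp_smul N t fun x => ∫⁻ y, ENNReal.ofReal (|u x - u y| ^ 2
          / ‖x - y‖ ^ ((N : ℝ) + 2 * s)), ← mul_assoc,
    ← ENNReal.ofReal_mul (Real.exp_pos _).le, ← Real.exp_add]
  ring_nf

/-- `ξ ↦ I_η(ξ⋆u)` is differentiable with derivative `s · P_η(ξ⋆u)`. -/
theorem deriv_energy_scaling (N : ℕ) (hN : 2 ≤ N) (s : ℝ) (hs : s ∈ Set.Ioo (0 : ℝ) 1)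
    (p η : ℝ) (hp : p ∈ Set.Ioo (2 : ℝ) (critExp N s)) (hη : 0 < η)
    (u : EuclideanSpace ℝ (Fin N) → ℝ) (hu : Measurable u)
    (hgag : gagliardo N s u ≠ ⊤) (hcrit : lpint N (critExp N s) u ≠ ⊤)
    (hLp : lpint N p u ≠ ⊤) :
    ∀ ξ : ℝ,
      HasDerivAt (fun t : ℝ => energy N s p η (scaleFn N t u))
        (s * pohozaev N s p η (scaleFn N ξ u)) ξ := by
  intro ξ
  obtain ⟨hs0, hs1⟩ := hs
  have hN' : (2 : ℝ) ≤ N := by exact_mod_cast hN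
  have hd : (N : ℝ) - 2 * s ≠ 0 := by linarith
  have hp0 : p ≠ 0 := by linarith [hp.1]
  have hq : critExp N s ≠ 0 := by linarith [hp.1, hp.2]
  have hqs : (N : ℝ) * critExp N s / 2 - N = s * critExp N s := by
    unfold critExp; field_simp; ring
  have hexp : ∀ c : ℝ, HasDerivAt (fun t : ℝ => Real.exp (c * t)) (Real.exp (c * ξ) * c) ξ :=
    fun c => by simpa using ((hasDerivAt_id ξ).const_mul c).exp
  simp only [energy, pohozaev, gagliardo_scaleFn, lpint_scaleFn, ENNReal.toReal_mul,
    ENNReal.toReal_ofReal (Real.exp_pos _).le, hqs]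
  refine (((((hexp _).mul_const _).const_mul _).sub (((hexp _).mul_const _).const_mul _)).sub
    (((hexp _).mul_const _).const_mul _)).congr_deriv ?_
  unfold zetaP
  generalize critExp N s = q at *
  field_simp
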